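/- Let C be a bivariate copula whose partial derivatives Ċ₁ and Ċ₂ exist everywhere on [0,1]² and take values in [0,1], and suppose C is left-tail decreasing (LTD), i.e. Ċ₁(u,v) ≤ C(u,v)/u and Ċ₂(u,v) ≤ C(u,v)/v for all u, v ∈ (0,1). Then for every finite nonnegative Borel measure μ on [0,1]², ∫∫ Γ̂(u,v,s,t) dμ(u,v) dμ(s,t) ≤ ∫∫ Γ(u,v,s,t) dμ(u,v) dμ(s,t); that is, the asymptotic variance of the rank-based plug-in estimator of a dependence parameter given by a non-decreasing Hadamard-differentiable functional is at most that of the plug-in estimator using known margins. -/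

import Mathlib

open Set

/-- Asymptotic covariance function of the standard empirical process based on
observations from the copula `C`: `Gamma C u v s t = C(u ∧ s, v ∧ t) - C(u,v)·C(s,t)`. -/
noncomputable def Gamma (C : ℝ → ℝ → ℝ) (u v s t : ℝ) : ℝ :=
  C (min u s) (min v t) - C u v * C s t

/-- Asymptotic covariance function of the empirical copula process, where `C1` and `C2`
denote the partial derivatives of the copula `C`. -/
noncomputable def GammaHat (C C1 C2 : ℝ → ℝ → ℝ) (u v s t : ℝ) : ℝ :=
  Gamma C u v s t
    - C1 u v * Gamma C u 1 s t - C2 u v * Gamma C 1 v s t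
    - C1 s t * Gamma C u v s 1 - C2 s t * Gamma C u v 1 t
    + C1 u v * C1 s t * Gamma C u 1 s 1
    + C1 u v * C2 s t * Gamma C u 1 1 t
    + C2 u v * C1 s t * Gamma C 1 v s 1
    + C2 u v * C2 s t * Gamma C 1 v 1 t

open MeasureTheory

/-- Order properties of a copula `C` for which `u ↦ C u v / u` and `v ↦ C u v / v` are
non-increasing. -/
structure IsTailDecreasing (C : ℝ → ℝ → ℝ) : Prop where
  nonneg : ∀ u ∈ Icc (0:ℝ) 1, ∀ v ∈ Icc (0:ℝ) 1, 0 ≤ C u v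
  le_left : ∀ u ∈ Icc (0:ℝ) 1, ∀ v ∈ Icc (0:ℝ) 1, C u v ≤ u
  le_right : ∀ u ∈ Icc (0:ℝ) 1, ∀ v ∈ Icc (0:ℝ) 1, C u v ≤ v
  one_right : ∀ u ∈ Icc (0:ℝ) 1, C u 1 = u
  one_left : ∀ v ∈ Icc (0:ℝ) 1, C 1 v = v
  ratio_left : ∀ u ∈ Icc (0:ℝ) 1, ∀ s ∈ Icc (0:ℝ) 1, ∀ v ∈ Icc (0:ℝ) 1,
    u ≤ s → u * C s v ≤ s * C u v
  ratio_right : ∀ u ∈ Icc (0:ℝ) 1, ∀ v ∈ Icc (0:ℝ) 1, ∀ t ∈ Icc (0:ℝ) 1,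
    v ≤ t → v * C u t ≤ t * C u v

theorem IsTailDecreasing.mul_le {C : ℝ → ℝ → ℝ} (h : IsTailDecreasing C) {u v : ℝ}
    (hu : u ∈ Icc (0:ℝ) 1) (hv : v ∈ Icc (0:ℝ) 1) : u * v ≤ C u v := by
  have := h.ratio_left u hu 1 (by simp) v hv hu.2
  rwa [h.one_left v hv, one_mul] at this

theorem affine_nonneg_of_endpoints {α β A x : ℝ} (hx : 0 ≤ x) (hxA : x ≤ A) (h0 : 0 ≤ α)
    (hA : 0 ≤ α + β * A) : 0 ≤ α + β * x := by
  rcases le_total 0 β with h | h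
  · positivity
  · nlinarith

theorem bilinear_nonneg_of_corners {α β γ δ A D x y : ℝ} (hx : 0 ≤ x) (hxA : x ≤ A) (hy : 0 ≤ y)
    (hyD : y ≤ D) (h00 : 0 ≤ α) (hA0 : 0 ≤ α + β * A) (h0D : 0 ≤ α + γ * D)
    (hAD : 0 ≤ α + β * A + γ * D + δ * A * D) : 0 ≤ α + β * x + γ * y + δ * x * y := by
  have h0 := affine_nonneg_of_endpoints hy hyD h00 h0D
  have hA := affine_nonneg_of_endpoints (α := α + β * A) (β := γ + δ * A) hy hyD hA0 (by linarith)
  have := affine_nonneg_of_endpoints (α := α + γ * y) (β := β + δ * y) hx hxA h0 (by linarith)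
  linarith

/-- The inequality behind the covariance comparison for two points in opposite order:
`P, Q, R, S` are the copula values at `(s,t)`, `(u,v)`, `(u,t)`, `(s,v)` with `u ≤ s`, `t ≤ v`. -/
theorem discordant_ineq {u v s t a b c d P Q R S : ℝ}
    (hu : 0 ≤ u) (hus : u ≤ s) (hs : s ≤ 1) (ht : 0 ≤ t) (htv : t ≤ v) (hv : v ≤ 1)
    (ha : 0 ≤ a) (hb : 0 ≤ b) (hc : 0 ≤ c) (hd : 0 ≤ d)
    (haQ : a * u ≤ Q) (hbQ : b * v ≤ Q) (hcP : c * s ≤ P) (hdP : d * t ≤ P)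
    (hPt : P ≤ t) (hQu : Q ≤ u) (hRu : R ≤ u) (hRt : R ≤ t)
    (hSs : S ≤ s) (hSv : S ≤ v) (hR : 0 ≤ R)
    (hRP : u * P ≤ s * R) (hRQ : t * Q ≤ v * R) :
    0 ≤ a * (R - u * P) + b * ((1 - v) * P) + c * ((1 - s) * Q) + d * (R - t * Q)
      - a * c * (u * (1 - s)) - a * d * (R - u * t) - b * c * (S - s * v)
      - b * d * (t * (1 - v)) := by
  have hP : 0 ≤ P := le_trans (by positivity) hdP
  have hQ : 0 ≤ Q := le_trans (by positivity) haQ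
  have hbc : 0 ≤ b * c := by positivity
  have hs' : 0 ≤ 1 - s := by linarith
  have hv' : 0 ≤ 1 - v := by linarith
  rcases hu.eq_or_lt with rfl | hu0
  · have hQ0 : Q = 0 := by linarith
    have hR0 : R = 0 := by linarith
    subst hQ0 hR0
    rcases (ht.trans htv).eq_or_lt with rfl | hv0
    · have ht0 : t = 0 := by linarith
      have hP0 : P = 0 := by linarith
      subst ht0 hP0
      nlinarith [mul_nonneg hbc (neg_nonneg.mpr hSv)]
    · have hb0 : b = 0 := by nlinarith
      simp [hb0]
  rcases ht.eq_or_lt with rfl | ht0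
  · have hP0 : P = 0 := by linarith
    have hR0 : R = 0 := by linarith
    have hc0 : c = 0 := by nlinarith
    simp [hP0, hR0, hc0]
  have hs0 : 0 < s := hu0.trans_le hus
  have hv0 : 0 < v := ht0.trans_le htv
  have hbcS : b * c * (S - s * v) ≤ b * (1 - v) * P + c * (1 - s) * Q := by
    have h1 := mul_le_mul_of_nonneg_left hcP (mul_nonneg hb hv')
    have h2 := mul_le_mul_of_nonneg_left hbQ (mul_nonneg hc hs')
    have h3 : S - s * v ≤ s + v - 2 * (s * v) := by
      linarith [mul_nonneg hv0.le hs']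
    have := mul_le_mul_of_nonneg_left h3 hbc
    linarith
  obtain ⟨A, hA⟩ : ∃ A, A = Q / u := ⟨_, rfl⟩
  obtain ⟨D, hD⟩ : ∃ D, D = P / t := ⟨_, rfl⟩
  have hAu : A * u = Q := by rw [hA]; field_simp
  have hDt : D * t = P := by rw [hD]; field_simp
  have haA : a ≤ A := by rw [hA, le_div_iff₀ hu0]; exact haQ
  have hdD : d ≤ D := by rw [hD, le_div_iff₀ ht0]; exact hdP
  have hA0 := ha.trans haA
  have hD0 := hd.trans hdD
  have hA1 : A ≤ 1 := by rw [hA, div_le_one hu0]; exact hQu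
  have hD1 : D ≤ 1 := by rw [hD, div_le_one ht0]; exact hPt
  have hDR : b * (1 - v) * P ≤ D * (R - t * Q) := by
    have h2 : b * (1 - v) * t ≤ R - t * Q := by
      refine le_of_mul_le_mul_left ?_ hv0
      have := mul_le_mul_of_nonneg_left hbQ (mul_nonneg ht hv')
      linarith
    calc b * (1 - v) * P = D * (b * (1 - v) * t) := by rw [← hDt]; ring
      _ ≤ _ := mul_le_mul_of_nonneg_left h2 hD0
  have hAR : c * (1 - s) * Q ≤ A * (R - u * P) := by
    have h2 : c * (1 - s) * u ≤ R - u * P := by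
      refine le_of_mul_le_mul_left ?_ hs0
      have := mul_le_mul_of_nonneg_left hcP (mul_nonneg hu hs')
      linarith
    calc c * (1 - s) * Q = A * (c * (1 - s) * u) := by rw [← hAu]; ring
      _ ≤ _ := mul_le_mul_of_nonneg_left h2 hA0
  have hAD : b * c * (S - s * v) ≤ A * (R - u * P) + D * (R - t * Q) - A * D * (R - u * t) := by
    have h1 : A * (R - u * P) + D * (R - t * Q) - A * D * (R - u * t)
        = A * (R - u * P) + D * (1 - A) * R := by
      rw [← hAu, ← hDt]; ring
    have h2 : b * c * (S - s * v) ≤ c * (1 - s) * Q := by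
      have := mul_le_mul_of_nonneg_left hbQ (mul_nonneg hc hs')
      have := mul_le_mul_of_nonneg_left hSv hbc
      linarith
    have h3 : 0 ≤ D * (1 - A) * R := by
      have : 0 ≤ 1 - A := by linarith
      positivity
    linarith
  have hAcu : A * c * (u * (1 - s)) = c * (1 - s) * Q := by rw [← hAu]; ring
  have hbDt : b * D * (t * (1 - v)) = b * (1 - v) * P := by rw [← hDt]; ring
  have := bilinear_nonneg_of_corners ha haA hd hdD
    (α := b * ((1 - v) * P) + c * ((1 - s) * Q) - b * c * (S - s * v))
    (β := R - u * P - c * (u * (1 - s))) (γ := R - t * Q - b * (t * (1 - v)))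
    (δ := -(R - u * t)) (by linarith) (by linarith) (by linarith) (by linarith)
  linarith

/-- The inequality behind the covariance comparison for two points in the same order:
`P, Q, R, S` are the copula values at `(s,t)`, `(u,v)`, `(u,t)`, `(s,v)` with `u ≤ s`, `v ≤ t`. -/
theorem concordant_ineq {u v s t a b c d P Q R S : ℝ}
    (hu : 0 ≤ u) (hs : s ≤ 1) (ht : t ≤ 1) (hv : 0 ≤ v)
    (ha : 0 ≤ a) (hb : 0 ≤ b) (hc : 0 ≤ c) (hd : 0 ≤ d) (hc1 : c ≤ 1) (hd1 : d ≤ 1)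
    (haQ : a * u ≤ Q) (hbQ : b * v ≤ Q)
    (hPt : P ≤ t) (hPs : P ≤ s) (hR : u * t ≤ R) (hS : s * v ≤ S) :
    0 ≤ a * (R - u * P) + b * (S - v * P) + c * ((1 - s) * Q) + d * ((1 - t) * Q)
      - a * c * (u * (1 - s)) - a * d * (R - u * t) - b * c * (S - s * v)
      - b * d * (v * (1 - t)) := by
  have h1 : 0 ≤ c * (1 - s) * (Q - a * u) :=
    mul_nonneg (mul_nonneg hc (by linarith)) (by linarith)
  have h2 : 0 ≤ d * (1 - t) * (Q - b * v) :=
    mul_nonneg (mul_nonneg hd (by linarith)) (by linarith)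
  have h3 : 0 ≤ a * ((1 - d) * (R - u * t) + u * (t - P)) :=
    mul_nonneg ha (add_nonneg (mul_nonneg (by linarith) (by linarith))
      (mul_nonneg hu (by linarith)))
  have h4 : 0 ≤ b * ((1 - c) * (S - s * v) + v * (s - P)) :=
    mul_nonneg hb (add_nonneg (mul_nonneg (by linarith) (by linarith))
      (mul_nonneg hv (by linarith)))
  linarith

theorem GammaHat_symm (C C1 C2 : ℝ → ℝ → ℝ) (u v s t : ℝ) :
    GammaHat C C1 C2 u v s t = GammaHat C C1 C2 s t u v := by
  simp only [GammaHat, Gamma, min_comm s u, min_comm t v, min_comm u 1, min_comm v 1,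
    min_comm s 1, min_comm t 1]
  ring

theorem Gamma_symm (C : ℝ → ℝ → ℝ) (u v s t : ℝ) : Gamma C u v s t = Gamma C s t u v := by
  simp only [Gamma, min_comm s u, min_comm t v]
  ring

theorem GammaHat_le_Gamma {C C1 C2 : ℝ → ℝ → ℝ} (h : IsTailDecreasing C)
    (hr1 : ∀ u ∈ Icc (0:ℝ) 1, ∀ v ∈ Icc (0:ℝ) 1, C1 u v ∈ Icc (0:ℝ) 1)
    (hr2 : ∀ u ∈ Icc (0:ℝ) 1, ∀ v ∈ Icc (0:ℝ) 1, C2 u v ∈ Icc (0:ℝ) 1)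
    (hl1 : ∀ u ∈ Icc (0:ℝ) 1, ∀ v ∈ Icc (0:ℝ) 1, C1 u v * u ≤ C u v)
    (hl2 : ∀ u ∈ Icc (0:ℝ) 1, ∀ v ∈ Icc (0:ℝ) 1, C2 u v * v ≤ C u v)
    {u v s t : ℝ} (hu : u ∈ Icc (0:ℝ) 1) (hv : v ∈ Icc (0:ℝ) 1) (hs : s ∈ Icc (0:ℝ) 1)
    (ht : t ∈ Icc (0:ℝ) 1) : GammaHat C C1 C2 u v s t ≤ Gamma C u v s t := by
  wlog hus : u ≤ s generalizing u v s t
  · rw [GammaHat_symm, Gamma_symm]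
    exact this hs ht hu hv (le_of_not_ge hus)
  rcases le_total v t with hvt | htv
  · have := concordant_ineq hu.1 hs.2 ht.2 hv.1 (hr1 u hu v hv).1 (hr2 u hu v hv).1
      (hr1 s hs t ht).1 (hr2 s hs t ht).1 (hr1 s hs t ht).2 (hr2 s hs t ht).2
      (hl1 u hu v hv) (hl2 u hu v hv) (h.le_right s hs t ht) (h.le_left s hs t ht)
      (h.mul_le hu ht) (h.mul_le hs hv)
    simp only [GammaHat, Gamma, min_eq_left hus, min_eq_left hvt, min_eq_left hu.2,
      min_eq_left hv.2, min_eq_right hs.2, min_eq_right ht.2, min_self, h.one_left _ hv,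
      h.one_left _ ht, h.one_right _ hu, h.one_right _ hs]
    linarith
  · have := discordant_ineq hu.1 hus hs.2 ht.1 htv hv.2 (hr1 u hu v hv).1 (hr2 u hu v hv).1
      (hr1 s hs t ht).1 (hr2 s hs t ht).1 (hl1 u hu v hv) (hl2 u hu v hv)
      (hl1 s hs t ht) (hl2 s hs t ht) (h.le_right s hs t ht) (h.le_left u hu v hv)
      (h.le_left u hu t ht) (h.le_right u hu t ht) (h.le_left s hs v hv) (h.le_right s hs v hv)
      (h.nonneg u hu t ht) (h.ratio_left u hu s hs t ht hus) (h.ratio_right u hu t ht v hv htv)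
    simp only [GammaHat, Gamma, min_eq_left hus, min_eq_right htv, min_eq_left hu.2,
      min_eq_left hv.2, min_eq_right hs.2, min_eq_right ht.2, min_self, h.one_left _ hv,
      h.one_left _ ht, h.one_right _ hu, h.one_right _ hs]
    linarith

open Filter Topology in
/-- If `x ↦ f x / x` is non-increasing then `f' u * u ≤ f u`. -/
theorem deriv_mul_le_of_ratio {f : ℝ → ℝ} {f' u : ℝ} (hu : u ∈ Icc (0:ℝ) 1)
    (hf : HasDerivWithinAt f f' (Icc 0 1) u)
    (hratio : ∀ x ∈ Icc (0:ℝ) 1, ∀ y ∈ Icc (0:ℝ) 1, x ≤ y → x * f y ≤ y * f x) :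
    f' * u ≤ f u := by
  have hne : (𝓝[Icc (0:ℝ) 1 \ {u}] u).NeBot :=
    accPt_principal_iff_nhdsWithin.1 (uniqueDiffOn_Icc zero_lt_one u hu).accPt
  refine le_of_tendsto ((hasDerivWithinAt_iff_tendsto_slope.1 hf).mul_const u) ?_
  filter_upwards [self_mem_nhdsWithin] with x hx
  rw [slope_def_field]
  rcases lt_or_gt_of_ne (show x ≠ u from hx.2) with hxu | hxu
  · have := hratio x hx.1 u hu hxu.le
    rw [div_mul_eq_mul_div, div_le_iff_of_neg (by linarith)]
    linarith
  · have := hratio u hu x hx.1 hxu.le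
    rw [div_mul_eq_mul_div, div_le_iff₀ (by linarith)]
    linarith

theorem ratio_of_deriv_le {f f' : ℝ → ℝ} (h0 : f 0 = 0)
    (hf : ∀ x ∈ Icc (0:ℝ) 1, HasDerivWithinAt f (f' x) (Icc 0 1) x)
    (hle : ∀ x ∈ Ioo (0:ℝ) 1, f' x ≤ f x / x) :
    ∀ x ∈ Icc (0:ℝ) 1, ∀ y ∈ Icc (0:ℝ) 1, x ≤ y → x * f y ≤ y * f x := by
  intro x hx y hy hxy
  rcases hx.1.eq_or_lt with rfl | hx0
  · simp [h0]
  have hcont : ContinuousOn (fun z => f z / z) (Ioc 0 1) :=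
    ContinuousOn.div (fun z hz => ((hf z (Ioc_subset_Icc_self hz)).continuousWithinAt).mono
      Ioc_subset_Icc_self) continuousOn_id (fun z hz => hz.1.ne')
  have hderiv : ∀ z ∈ interior (Ioc (0:ℝ) 1),
      HasDerivWithinAt (fun z => f z / z) ((f' z * z - f z * 1) / z ^ 2)
        (interior (Ioc (0:ℝ) 1)) z := by
    intro z hz
    rw [interior_Ioc] at hz
    exact ((((hf z (Ioo_subset_Icc_self hz)).hasDerivAt (Icc_mem_nhds hz.1 hz.2)).div
      (hasDerivAt_id z) hz.1.ne')).hasDerivWithinAt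
  have hanti := antitoneOn_of_hasDerivWithinAt_nonpos (convex_Ioc 0 1) hcont hderiv
    (fun z hz => by
      rw [interior_Ioc] at hz
      refine div_nonpos_of_nonpos_of_nonneg ?_ (sq_nonneg z)
      have := (le_div_iff₀ hz.1).1 (hle z hz)
      linarith)
  have := hanti ⟨hx0, hx.2⟩ ⟨hx0.trans_le hxy, hy.2⟩ hxy
  simp only at this
  rw [div_le_div_iff₀ (hx0.trans_le hxy) hx0] at this
  linarith

open Filter Topology in
/-- Partial derivatives within `[0,1]`, composed with the projection onto the unit square,
are measurable. -/
theorem measurable_partialDeriv_clamp {F F1 : ℝ → ℝ → ℝ} {r : ℝ → ℝ} (hr : Measurable r)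
    (hr01 : ∀ x, r x ∈ Icc (0:ℝ) 1)
    (hF : Measurable fun p : Icc (0:ℝ) 1 × Icc (0:ℝ) 1 => F p.1 p.2)
    (hd : ∀ u ∈ Icc (0:ℝ) 1, ∀ v ∈ Icc (0:ℝ) 1,
      HasDerivWithinAt (fun x => F x v) (F1 u v) (Icc 0 1) u) :
    Measurable fun p : ℝ × ℝ => F1 (r p.1) (r p.2) := by
  let e : ℕ → ℝ := fun n => 1 / ((n:ℝ) + 2)
  have he0 : ∀ n, 0 < e n := fun n => by positivity
  have he1 : ∀ n, e n ≤ 1 / 2 := fun n => by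
    apply one_div_le_one_div_of_le <;> norm_num
  have het : Tendsto e atTop (𝓝 0) := by
    have := (tendsto_add_atTop_iff_nat 2).2 (tendsto_one_div_atTop_nhds_zero_nat (𝕜 := ℝ))
    simpa [e] using this
  let g : ℕ → ℝ → ℝ := fun n x => if x ≤ 1 / 2 then x + e n else x - e n
  have hg : ∀ n, Measurable (g n) := fun n =>
    Measurable.ite measurableSet_Iic (by fun_prop) (by fun_prop)
  have hg01 : ∀ n, ∀ x ∈ Icc (0:ℝ) 1, g n x ∈ Icc (0:ℝ) 1 := by
    intro n x hx
    have h0 := he0 n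
    have h1 := he1 n
    simp only [g]
    split_ifs with h
    · exact ⟨by linarith [hx.1], by linarith⟩
    · exact ⟨by linarith, by linarith [hx.2]⟩
  have hgne : ∀ n x, g n x ≠ x := by
    intro n x
    have h0 := he0 n
    simp only [g]
    split_ifs <;> linarith
  have hgt : ∀ x, Tendsto (fun n => g n x) atTop (𝓝 x) := by
    intro x
    simp only [g]
    split_ifs
    · simpa using het.const_add x
    · simpa using het.const_sub x
  have hFc : ∀ a b : ℝ × ℝ → ℝ, Measurable a → Measurable b → (∀ p, a p ∈ Icc (0:ℝ) 1) →
      (∀ p, b p ∈ Icc (0:ℝ) 1) → Measurable fun p => F (a p) (b p) :=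
    fun a b ha hb ha' hb' =>
      hF.comp ((ha.subtype_mk (h := ha')).prodMk (hb.subtype_mk (h := hb')))
  refine measurable_of_tendsto_metrizable (f := fun n (p : ℝ × ℝ) =>
    slope (fun x => F x (r p.2)) (r p.1) (g n (r p.1))) (fun n => ?_) ?_
  · simp only [slope_def_field]
    refine ((hFc _ _ ((hg n).comp (hr.comp measurable_fst)) (hr.comp measurable_snd)
      (fun p => hg01 n _ (hr01 _)) (fun p => hr01 _)).sub
      (hFc _ _ (hr.comp measurable_fst) (hr.comp measurable_snd)
      (fun p => hr01 _) (fun p => hr01 _))).div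
      (((hg n).comp (hr.comp measurable_fst)).sub (hr.comp measurable_fst))
  · rw [tendsto_pi_nhds]
    intro p
    refine (hasDerivWithinAt_iff_tendsto_slope.1 (hd _ (hr01 p.1) _ (hr01 p.2))).comp ?_
    exact tendsto_nhdsWithin_iff.2 ⟨hgt _, Eventually.of_forall fun n =>
      ⟨hg01 n _ (hr01 _), hgne n _⟩⟩

theorem isTailDecreasing_of_derivs {C C1 C2 : ℝ → ℝ → ℝ}
    (hbot : ∀ u ∈ Icc (0:ℝ) 1, C u 0 = 0)
    (hbot' : ∀ v ∈ Icc (0:ℝ) 1, C 0 v = 0)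
    (htop : ∀ u ∈ Icc (0:ℝ) 1, C u 1 = u)
    (htop' : ∀ v ∈ Icc (0:ℝ) 1, C 1 v = v)
    (hinc : ∀ u s v t : ℝ, 0 ≤ u → u ≤ s → s ≤ 1 → 0 ≤ v → v ≤ t → t ≤ 1 →
      0 ≤ C s t - C s v - C u t + C u v)
    (hd1 : ∀ u ∈ Icc (0:ℝ) 1, ∀ v ∈ Icc (0:ℝ) 1,
      HasDerivWithinAt (fun x => C x v) (C1 u v) (Icc 0 1) u)
    (hd2 : ∀ u ∈ Icc (0:ℝ) 1, ∀ v ∈ Icc (0:ℝ) 1,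
      HasDerivWithinAt (fun y => C u y) (C2 u v) (Icc 0 1) v)
    (hltd1 : ∀ u ∈ Ioo (0:ℝ) 1, ∀ v ∈ Ioo (0:ℝ) 1, C1 u v ≤ C u v / u)
    (hltd2 : ∀ u ∈ Ioo (0:ℝ) 1, ∀ v ∈ Ioo (0:ℝ) 1, C2 u v ≤ C u v / v) :
    IsTailDecreasing C where
  nonneg u hu v hv := by
    have := hinc 0 u 0 v le_rfl hu.1 hu.2 le_rfl hv.1 hv.2
    simp only [hbot u hu, hbot' v hv, hbot 0 (by simp)] at this
    linarith
  le_left u hu v hv := by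
    have := hinc 0 u v 1 le_rfl hu.1 hu.2 hv.1 hv.2 le_rfl
    simp only [htop u hu, hbot' v hv, hbot' 1 (by simp)] at this
    linarith
  le_right u hu v hv := by
    have := hinc u 1 0 v hu.1 hu.2 le_rfl le_rfl hv.1 hv.2
    simp only [htop' v hv, hbot u hu, hbot 1 (by simp)] at this
    linarith
  one_right := htop
  one_left := htop'
  ratio_left u hu s hs v hv hus := by
    rcases hv.1.eq_or_lt with rfl | hv0
    · simp [hbot u hu, hbot s hs]
    rcases hv.2.eq_or_lt with rfl | hv1
    · simp [htop u hu, htop s hs, mul_comm]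
    exact ratio_of_deriv_le (hbot' v hv) (fun x hx => hd1 x hx v hv)
      (fun x hx => hltd1 x hx v ⟨hv0, hv1⟩) u hu s hs hus
  ratio_right u hu v hv t ht hvt := by
    rcases hu.1.eq_or_lt with rfl | hu0
    · simp [hbot' v hv, hbot' t ht]
    rcases hu.2.eq_or_lt with rfl | hu1
    · simp [htop' v hv, htop' t ht, mul_comm]
    exact ratio_of_deriv_le (hbot u hu) (fun x hx => hd2 u hu x hx)
      (fun x hx => hltd2 u ⟨hu0, hu1⟩ x hx) v hv t ht hvt

theorem IsTailDecreasing.abs_Gamma_le {C : ℝ → ℝ → ℝ} (h : IsTailDecreasing C) {u v s t : ℝ}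
    (hu : u ∈ Icc (0:ℝ) 1) (hv : v ∈ Icc (0:ℝ) 1) (hs : s ∈ Icc (0:ℝ) 1)
    (ht : t ∈ Icc (0:ℝ) 1) : |Gamma C u v s t| ≤ 1 := by
  have hmin : ∀ a ∈ Icc (0:ℝ) 1, ∀ b ∈ Icc (0:ℝ) 1, min a b ∈ Icc (0:ℝ) 1 :=
    fun a ha b hb => ⟨le_min ha.1 hb.1, (min_le_left _ _).trans ha.2⟩
  have hC : ∀ a ∈ Icc (0:ℝ) 1, ∀ b ∈ Icc (0:ℝ) 1, C a b ∈ Icc (0:ℝ) 1 :=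
    fun a ha b hb => ⟨h.nonneg a ha b hb, (h.le_left a ha b hb).trans ha.2⟩
  have h1 := hC _ (hmin u hu s hs) _ (hmin v hv t ht)
  have h2 := hC u hu v hv
  have h3 := hC s hs t ht
  have h4 := mul_nonneg h2.1 h3.1
  have h5 := mul_le_one₀ h2.2 h3.1 h3.2
  rw [Gamma, abs_le]
  constructor <;> linarith [h1.1, h1.2]

theorem IsTailDecreasing.abs_GammaHat_le {C C1 C2 : ℝ → ℝ → ℝ} (h : IsTailDecreasing C)
    (hr1 : ∀ u ∈ Icc (0:ℝ) 1, ∀ v ∈ Icc (0:ℝ) 1, C1 u v ∈ Icc (0:ℝ) 1)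
    (hr2 : ∀ u ∈ Icc (0:ℝ) 1, ∀ v ∈ Icc (0:ℝ) 1, C2 u v ∈ Icc (0:ℝ) 1) {u v s t : ℝ}
    (hu : u ∈ Icc (0:ℝ) 1) (hv : v ∈ Icc (0:ℝ) 1) (hs : s ∈ Icc (0:ℝ) 1)
    (ht : t ∈ Icc (0:ℝ) 1) : |GammaHat C C1 C2 u v s t| ≤ 9 := by
  have h1 : (1:ℝ) ∈ Icc (0:ℝ) 1 := by simp
  have hmul : ∀ a ∈ Icc (0:ℝ) 1, ∀ x : ℝ, |x| ≤ 1 → |a * x| ≤ 1 := by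
    intro a ha x hx
    rw [abs_mul, abs_of_nonneg ha.1]
    exact mul_le_one₀ ha.2 (abs_nonneg x) hx
  have hmul2 : ∀ a ∈ Icc (0:ℝ) 1, ∀ b ∈ Icc (0:ℝ) 1, a * b ∈ Icc (0:ℝ) 1 :=
    fun a ha b hb => ⟨mul_nonneg ha.1 hb.1, mul_le_one₀ ha.2 hb.1 hb.2⟩
  have ha := hr1 u hu v hv
  have hb := hr2 u hu v hv
  have hc := hr1 s hs t ht
  have hd := hr2 s hs t ht
  have e0 := abs_le.1 (h.abs_Gamma_le hu hv hs ht)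
  have e1 := abs_le.1 (hmul _ ha _ (h.abs_Gamma_le hu h1 hs ht))
  have e2 := abs_le.1 (hmul _ hb _ (h.abs_Gamma_le h1 hv hs ht))
  have e3 := abs_le.1 (hmul _ hc _ (h.abs_Gamma_le hu hv hs h1))
  have e4 := abs_le.1 (hmul _ hd _ (h.abs_Gamma_le hu hv h1 ht))
  have e5 := abs_le.1 (hmul _ (hmul2 _ ha _ hc) _ (h.abs_Gamma_le hu h1 hs h1))
  have e6 := abs_le.1 (hmul _ (hmul2 _ ha _ hd) _ (h.abs_Gamma_le hu h1 h1 ht))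
  have e7 := abs_le.1 (hmul _ (hmul2 _ hb _ hc) _ (h.abs_Gamma_le h1 hv hs h1))
  have e8 := abs_le.1 (hmul _ (hmul2 _ hb _ hd) _ (h.abs_Gamma_le h1 hv h1 ht))
  rw [GammaHat, abs_le]
  constructor <;> linarith [e0.1, e0.2, e1.1, e1.2, e2.1, e2.2, e3.1, e3.2, e4.1, e4.2, e5.1,
    e5.2, e6.1, e6.2, e7.1, e7.2, e8.1, e8.2]

/-- A function separately continuous on the unit square is measurable there. -/
theorem measurable_of_hasDerivWithinAt {C C1 C2 : ℝ → ℝ → ℝ}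
    (hd1 : ∀ u ∈ Icc (0:ℝ) 1, ∀ v ∈ Icc (0:ℝ) 1,
      HasDerivWithinAt (fun x => C x v) (C1 u v) (Icc 0 1) u)
    (hd2 : ∀ u ∈ Icc (0:ℝ) 1, ∀ v ∈ Icc (0:ℝ) 1,
      HasDerivWithinAt (fun y => C u y) (C2 u v) (Icc 0 1) v) :
    Measurable fun p : Icc (0:ℝ) 1 × Icc (0:ℝ) 1 => C p.1 p.2 := by
  have h1 : ∀ v : Icc (0:ℝ) 1, Continuous fun u : Icc (0:ℝ) 1 => C u v := fun v =>
    continuousOn_iff_continuous_domRestrict.1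
      (fun u hu => (hd1 u hu v v.2).continuousWithinAt)
  have h2 : ∀ u : Icc (0:ℝ) 1, Continuous fun v : Icc (0:ℝ) 1 => C u v := fun u =>
    continuousOn_iff_continuous_domRestrict.1
      (fun v hv => (hd2 u u.2 v hv).continuousWithinAt)
  exact measurable_uncurry_of_continuous_of_measurable
    (u := fun (u v : Icc (0:ℝ) 1) => C u v) h1 (fun u => (h2 u).measurable)

/-- **Proposition 3 (Genest–Segers).** If the copula `C` is left-tail decreasing (with partial
derivatives existing everywhere on `[0,1]²` and taking values in `[0,1]`), then for every finite
nonnegative Borel measure `μ` concentrated on `[0,1]²`, the asymptotic variance of the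
rank-based plug-in estimator, `∫∫ GammaHat dμ dμ`, is at most the asymptotic variance of the
known-margins plug-in estimator, `∫∫ Gamma dμ dμ`. -/
theorem variance_rank_estimator_le (C C1 C2 : ℝ → ℝ → ℝ)
    (hbot : ∀ u ∈ Icc (0:ℝ) 1, C u 0 = 0)
    (hbot' : ∀ v ∈ Icc (0:ℝ) 1, C 0 v = 0)
    (htop : ∀ u ∈ Icc (0:ℝ) 1, C u 1 = u)
    (htop' : ∀ v ∈ Icc (0:ℝ) 1, C 1 v = v)
    (hinc : ∀ u s v t : ℝ, 0 ≤ u → u ≤ s → s ≤ 1 → 0 ≤ v → v ≤ t → t ≤ 1 →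
      0 ≤ C s t - C s v - C u t + C u v)
    (hd1 : ∀ u ∈ Icc (0:ℝ) 1, ∀ v ∈ Icc (0:ℝ) 1,
      HasDerivWithinAt (fun x => C x v) (C1 u v) (Icc 0 1) u)
    (hd2 : ∀ u ∈ Icc (0:ℝ) 1, ∀ v ∈ Icc (0:ℝ) 1,
      HasDerivWithinAt (fun y => C u y) (C2 u v) (Icc 0 1) v)
    (hr1 : ∀ u ∈ Icc (0:ℝ) 1, ∀ v ∈ Icc (0:ℝ) 1, C1 u v ∈ Icc (0:ℝ) 1)
    (hr2 : ∀ u ∈ Icc (0:ℝ) 1, ∀ v ∈ Icc (0:ℝ) 1, C2 u v ∈ Icc (0:ℝ) 1)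
    (hltd1 : ∀ u ∈ Ioo (0:ℝ) 1, ∀ v ∈ Ioo (0:ℝ) 1, C1 u v ≤ C u v / u)
    (hltd2 : ∀ u ∈ Ioo (0:ℝ) 1, ∀ v ∈ Ioo (0:ℝ) 1, C2 u v ≤ C u v / v)
    (μ : Measure (ℝ × ℝ)) [IsFiniteMeasure μ]
    (hμ : μ ((Icc (0:ℝ) 1 ×ˢ Icc (0:ℝ) 1)ᶜ) = 0) :
    ∫ q, ∫ p, GammaHat C C1 C2 p.1 p.2 q.1 q.2 ∂μ ∂μ
      ≤ ∫ q, ∫ p, Gamma C p.1 p.2 q.1 q.2 ∂μ ∂μ := by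
  have h := isTailDecreasing_of_derivs hbot hbot' htop htop' hinc hd1 hd2 hltd1 hltd2
  have hl1 : ∀ u ∈ Icc (0:ℝ) 1, ∀ v ∈ Icc (0:ℝ) 1, C1 u v * u ≤ C u v := fun u hu v hv =>
    deriv_mul_le_of_ratio (f := fun x => C x v) hu (hd1 u hu v hv)
      (fun x hx y hy hxy => h.ratio_left x hx y hy v hv hxy)
  have hl2 : ∀ u ∈ Icc (0:ℝ) 1, ∀ v ∈ Icc (0:ℝ) 1, C2 u v * v ≤ C u v := fun u hu v hv =>
    deriv_mul_le_of_ratio (f := fun y => C u y) hv (hd2 u hu v hv)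
      (fun x hx y hy hxy => h.ratio_right u hu x hx y hy hxy)
  let r : ℝ → ℝ := fun x => max 0 (min 1 x)
  have hr : Measurable r := by fun_prop
  have hr01 : ∀ x, r x ∈ Icc (0:ℝ) 1 := fun x =>
    ⟨le_max_left _ _, max_le zero_le_one (min_le_left _ _)⟩
  have hrid : ∀ x ∈ Icc (0:ℝ) 1, r x = x := fun x hx => by
    simp [r, min_eq_right hx.2, max_eq_right hx.1]
  have hC := measurable_of_hasDerivWithinAt hd1 hd2
  have hCr : ∀ a b : (ℝ × ℝ) × (ℝ × ℝ) → ℝ, Measurable a → Measurable b →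
      Measurable fun z => C (r (a z)) (r (b z)) := fun a b ha hb =>
    hC.comp (((hr.comp ha).subtype_mk (h := fun z => hr01 _)).prodMk
      ((hr.comp hb).subtype_mk (h := fun z => hr01 _)))
  have hC1 := measurable_partialDeriv_clamp hr hr01 hC hd1
  have hC2 := (measurable_partialDeriv_clamp (F := fun x y => C y x) (F1 := fun x y => C2 y x)
    hr hr01 (hC.comp measurable_swap) (fun u hu v hv => hd2 v hv u hu)).comp measurable_swap
  let K : ℝ → ℝ → ℝ := fun x y => C (r x) (r y)
  let K1 : ℝ → ℝ → ℝ := fun x y => C1 (r x) (r y)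
  let K2 : ℝ → ℝ → ℝ := fun x y => C2 (r x) (r y)
  have hGm : ∀ a b c d : (ℝ × ℝ) × (ℝ × ℝ) → ℝ, Measurable a → Measurable b → Measurable c →
      Measurable d → Measurable fun z => Gamma K (a z) (b z) (c z) (d z) :=
    fun a b c d ha hb hc hd =>
      (hCr _ _ (ha.min hc) (hb.min hd)).sub ((hCr _ _ ha hb).mul (hCr _ _ hc hd))
  have hae : ∀ᵐ z ∂μ.prod μ, z.1 ∈ Icc (0:ℝ) 1 ×ˢ Icc (0:ℝ) 1 ∧
      z.2 ∈ Icc (0:ℝ) 1 ×ˢ Icc (0:ℝ) 1 :=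
    (Measure.quasiMeasurePreserving_fst.ae hμ).and (Measure.quasiMeasurePreserving_snd.ae hμ)
  have hGeq : ∀ u ∈ Icc (0:ℝ) 1, ∀ v ∈ Icc (0:ℝ) 1, ∀ s ∈ Icc (0:ℝ) 1, ∀ t ∈ Icc (0:ℝ) 1,
      Gamma K u v s t = Gamma C u v s t := by
    intro u hu v hv s hs t ht
    have hmin : ∀ a ∈ Icc (0:ℝ) 1, ∀ b ∈ Icc (0:ℝ) 1, min a b ∈ Icc (0:ℝ) 1 :=
      fun a ha b hb => ⟨le_min ha.1 hb.1, (min_le_left _ _).trans ha.2⟩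
    simp only [Gamma, K, hrid _ (hmin u hu s hs), hrid _ (hmin v hv t ht), hrid u hu, hrid v hv,
      hrid s hs, hrid t ht]
  have hG : Integrable (fun z : (ℝ × ℝ) × (ℝ × ℝ) => Gamma C z.1.1 z.1.2 z.2.1 z.2.2)
      (μ.prod μ) := by
    refine Integrable.of_bound (C := 1) ?_ ?_
    · refine (hGm (fun z => z.1.1) (fun z => z.1.2) (fun z => z.2.1) (fun z => z.2.2)
        (by fun_prop) (by fun_prop) (by fun_prop) (by fun_prop)).aestronglyMeasurable.congr ?_
      filter_upwards [hae] with z hz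
      exact hGeq _ hz.1.1 _ hz.1.2 _ hz.2.1 _ hz.2.2
    · filter_upwards [hae] with z hz
      exact h.abs_Gamma_le hz.1.1 hz.1.2 hz.2.1 hz.2.2
  have hGH : Integrable
      (fun z : (ℝ × ℝ) × (ℝ × ℝ) => GammaHat C C1 C2 z.1.1 z.1.2 z.2.1 z.2.2) (μ.prod μ) := by
    refine Integrable.of_bound (C := 9) ?_ ?_
    · have hm : Measurable fun z : (ℝ × ℝ) × (ℝ × ℝ) =>
          GammaHat K K1 K2 z.1.1 z.1.2 z.2.1 z.2.2 := by
        have m1 : Measurable fun z : (ℝ × ℝ) × (ℝ × ℝ) => K1 z.1.1 z.1.2 := hC1.comp measurable_fst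
        have m2 : Measurable fun z : (ℝ × ℝ) × (ℝ × ℝ) => K2 z.1.1 z.1.2 := hC2.comp measurable_fst
        have m3 : Measurable fun z : (ℝ × ℝ) × (ℝ × ℝ) => K1 z.2.1 z.2.2 := hC1.comp measurable_snd
        have m4 : Measurable fun z : (ℝ × ℝ) × (ℝ × ℝ) => K2 z.2.1 z.2.2 := hC2.comp measurable_snd
        have p1 : Measurable fun z : (ℝ × ℝ) × (ℝ × ℝ) => z.1.1 := by fun_prop
        have p2 : Measurable fun z : (ℝ × ℝ) × (ℝ × ℝ) => z.1.2 := by fun_prop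
        have p3 : Measurable fun z : (ℝ × ℝ) × (ℝ × ℝ) => z.2.1 := by fun_prop
        have p4 : Measurable fun z : (ℝ × ℝ) × (ℝ × ℝ) => z.2.2 := by fun_prop
        have o : Measurable fun _ : (ℝ × ℝ) × (ℝ × ℝ) => (1:ℝ) := measurable_const
        exact ((((((((hGm _ _ _ _ p1 p2 p3 p4).sub (m1.mul (hGm _ _ _ _ p1 o p3 p4))).sub
          (m2.mul (hGm _ _ _ _ o p2 p3 p4))).sub (m3.mul (hGm _ _ _ _ p1 p2 p3 o))).sub
          (m4.mul (hGm _ _ _ _ p1 p2 o p4))).add ((m1.mul m3).mul (hGm _ _ _ _ p1 o p3 o))).add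
          ((m1.mul m4).mul (hGm _ _ _ _ p1 o o p4))).add
          ((m2.mul m3).mul (hGm _ _ _ _ o p2 p3 o))).add
          ((m2.mul m4).mul (hGm _ _ _ _ o p2 o p4))
      refine hm.aestronglyMeasurable.congr ?_
      filter_upwards [hae] with z ⟨⟨h1, h2⟩, ⟨h3, h4⟩⟩
      have o : (1:ℝ) ∈ Icc (0:ℝ) 1 := by simp
      simp only [GammaHat, hGeq _ h1 _ h2 _ h3 _ h4, hGeq _ h1 _ o _ h3 _ h4,
        hGeq _ o _ h2 _ h3 _ h4, hGeq _ h1 _ h2 _ h3 _ o, hGeq _ h1 _ h2 _ o _ h4,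
        hGeq _ h1 _ o _ h3 _ o, hGeq _ h1 _ o _ o _ h4, hGeq _ o _ h2 _ h3 _ o,
        hGeq _ o _ h2 _ o _ h4, K1, K2, hrid _ h1, hrid _ h2, hrid _ h3, hrid _ h4]
    · filter_upwards [hae] with z hz
      exact h.abs_GammaHat_le hr1 hr2 hz.1.1 hz.1.2 hz.2.1 hz.2.2
  rw [← integral_prod_symm _ hGH, ← integral_prod_symm _ hG]
  refine integral_mono_ae hGH hG ?_
  filter_upwards [hae] with z hz
  exact GammaHat_le_Gamma h hr1 hr2 hl1 hl2 hz.1.1 hz.1.2 hz.2.1 hz.2.2
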